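/- (Theorem 3.1) Let 1 < α < 2, μ < 0, C > 0, M > 0, and let S_α : [0,∞) → B(X) be a strongly continuous family of bounded linear operators on a Banach space X with S_α(0) = I and ‖S_α(t)‖ ≤ CM/(1 + |μ|t^α) for all t ≥ 0. Let r > 0, ω > 0, φ ∈ C = C([−r,0],X), and let g, f : [0,∞) × C → X satisfy: g, f ∈ PSAP_{ω,r}(C,X); g(·,0), f(·,0) ∈ C_b([0,∞),X); and there exist bounded continuous functions L_g, L_f : [0,∞) → ℝ⁺ with ‖g(t,ψ)−g(t,φ)‖ ≤ L_g(t)‖ψ−φ‖_C and ‖f(t,ψ)−f(t,φ)‖ ≤ L_f(t)‖ψ−φ‖_C for all t ≥ 0 and ψ, φ ∈ C. If ‖L_g‖_∞ + ‖L_f‖_∞ · CM|μ|^{−1/α}π/(α sin(π/α)) < 1, then there exists a unique function u ∈ C_b([−r,∞),X) with u_0 = φ, u(t) = S_α(t)[φ(0) − g(0,φ)] + g(t,u_t) + ∫_0^t S_α(t−s) f(s,u_s) ds for all t ≥ 0, and the restriction of u to [0,∞) belongs to PSAP_{ω,r}(X). -/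

import Mathlib

open MeasureTheory Filter Set

/-- `v ∈ PSAP_{ω,r}(Y)`: pseudo S-asymptotically ω-periodic of class r. -/
def PSAPclass {Y : Type*} [NormedAddCommGroup Y] (ω r : ℝ) (v : ℝ → Y) : Prop :=
  Tendsto (fun T : ℝ => (1 / T) * ∫ s in r..T, ⨆ τ ∈ Set.Icc (s - r) s, ‖v (τ + ω) - v τ‖)
    atTop (nhds 0)

/-- `F ∈ PSAP_{ω,r}(E,Y)`: uniformly pseudo S-asymptotically ω-periodic of class r. -/
def PSAPunif {E Y : Type*} [NormedAddCommGroup E] [NormedAddCommGroup Y] (ω r : ℝ)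
    (F : ℝ → E → Y) : Prop :=
  ∀ L > 0, Tendsto (fun T : ℝ => (1 / T) * ∫ s in r..T,
      ⨆ τ ∈ Set.Icc (s - r) s, ⨆ x ∈ {x : E | ‖x‖ ≤ L}, ‖F (τ + ω) x - F τ x‖)
    atTop (nhds 0)

/-- The history `u_t ∈ C([−r,0],X)`, `u_t(θ) = u(t+θ)`. -/
noncomputable def hist {X : Type*} [NormedAddCommGroup X] (r : ℝ) (u : ℝ → X) (t : ℝ) :
    C(Set.Icc (-r) (0:ℝ), X) := by
  classical
  exact if h : Continuous (fun θ : Set.Icc (-r) (0:ℝ) => u (t + ↑θ)) then ⟨_, h⟩ else 0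

/-- `u` is a mild solution of system (1.2) with initial history `φ`:
`u ∈ C_b([−r,∞),X)`, `u_0 = φ`, and
`u(t) = S_α(t)[φ(0) − g(0,φ)] + g(t,u_t) + ∫_0^t S_α(t−s) f(s,u_s) ds` for `t ≥ 0`. -/
def IsMildSolution {X : Type*} [NormedAddCommGroup X] [NormedSpace ℝ X]
    (r : ℝ) (h0 : (0:ℝ) ∈ Set.Icc (-r) (0:ℝ))
    (S : ℝ → X →L[ℝ] X) (φ : C(Set.Icc (-r) (0:ℝ), X))
    (g f : ℝ → C(Set.Icc (-r) (0:ℝ), X) → X) (u : ℝ → X) : Prop :=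
  ContinuousOn u (Set.Ici (-r)) ∧ (∃ B, ∀ t ≥ -r, ‖u t‖ ≤ B) ∧
  (∀ θ : Set.Icc (-r) (0:ℝ), u ↑θ = φ θ) ∧
  ∀ t ≥ (0:ℝ), u t = S t (φ ⟨0, h0⟩ - g 0 φ) + g t (hist r u t) +
    ∫ s in (0:ℝ)..t, S (t - s) (f s (hist r u s))

/-- The value of `∫₀^∞ dx / (1 + c x ^ p)`, as a Lebesgue integral. -/
theorem lintegral_one_div_one_add_mul_rpow {p c : ℝ} (hp : 1 < p) (hc : 0 < c) :
    ∫⁻ x in Ioi (0 : ℝ), ENNReal.ofReal (1 / (1 + c * x ^ p)) =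
      ENNReal.ofReal (c ^ (-(1 / p)) * Real.pi / (p * Real.sin (Real.pi / p))) := by
  have hp0 : 0 < p := by linarith
  have hp1 : 1 / p < 1 := by rw [div_lt_one hp0]; exact hp
  have hp2 : 0 < 1 / p := by positivity
  have step1 : ∀ x ∈ Ioi (0 : ℝ), ENNReal.ofReal (1 / (1 + c * x ^ p)) =
      ∫⁻ s in Ioi (0 : ℝ), ENNReal.ofReal (Real.exp (-s) * Real.exp (-(c * s) * x ^ p)) := by
    intro x hx
    have hxp : 0 ≤ x ^ p := Real.rpow_nonneg (le_of_lt hx) p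
    have hpos : 0 < 1 + c * x ^ p := by positivity
    have hint : ∫ s in Ioi (0 : ℝ), Real.exp (-(1 + c * x ^ p) * s) = 1 / (1 + c * x ^ p) := by
      rw [integral_exp_mul_Ioi (by linarith), mul_zero, Real.exp_zero, neg_div_neg_eq]
    have hne : Integrable (fun s => Real.exp (-(1 + c * x ^ p) * s))
        (volume.restrict (Ioi (0 : ℝ))) :=
      Integrable.of_integral_ne_zero (by rw [hint]; positivity)
    rw [← hint, ofReal_integral_eq_lintegral_ofReal hne
      (Eventually.of_forall fun s => (Real.exp_pos _).le)]
    refine lintegral_congr fun s => ?_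
    rw [← Real.exp_add]
    congr 2
    ring_nf
  have step2 : ∀ s ∈ Ioi (0 : ℝ),
      ∫⁻ x in Ioi (0 : ℝ), ENNReal.ofReal (Real.exp (-s) * Real.exp (-(c * s) * x ^ p)) =
      ENNReal.ofReal (c ^ (-(1 / p)) * Real.Gamma (1 / p + 1) *
        (s ^ ((1 - 1 / p) - 1) * Real.exp (-(1 * s)))) := by
    intro s hs
    have hs0 : 0 < s := hs
    have hcs : 0 < c * s := by positivity
    have hint := integral_exp_neg_mul_rpow hp0 hcs
    have hG : 0 < Real.Gamma (1 / p + 1) := Real.Gamma_pos_of_pos (by positivity)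
    have hne : Integrable (fun x : ℝ => Real.exp (-(c * s) * x ^ p))
        (volume.restrict (Ioi (0 : ℝ))) :=
      Integrable.of_integral_ne_zero (by rw [hint]; positivity)
    rw [← ofReal_integral_eq_lintegral_ofReal (hne.const_mul _)
      (Eventually.of_forall fun x => by positivity), integral_const_mul, hint,
      Real.mul_rpow hc.le hs0.le]
    congr 1
    rw [show (1 - 1 / p) - 1 = -(1 / p) by ring, show -1 / p = -(1 / p) by ring, one_mul]
    ring
  rw [setLIntegral_congr_fun measurableSet_Ioi step1, lintegral_lintegral_swap,
    setLIntegral_congr_fun measurableSet_Ioi step2]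
  · have hint := Real.integral_rpow_mul_exp_neg_mul_Ioi (a := 1 - 1 / p) (r := 1)
      (by linarith) one_pos
    have hG : 0 < Real.Gamma (1 / p + 1) := Real.Gamma_pos_of_pos (by positivity)
    have hG' : 0 < Real.Gamma (1 - 1 / p) := Real.Gamma_pos_of_pos (by linarith)
    have hne : Integrable (fun s : ℝ => s ^ ((1 - 1 / p) - 1) * Real.exp (-(1 * s)))
        (volume.restrict (Ioi (0 : ℝ))) :=
      Integrable.of_integral_ne_zero (by rw [hint]; positivity)
    rw [← ofReal_integral_eq_lintegral_ofReal (hne.const_mul _)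
      ((ae_restrict_iff' measurableSet_Ioi).mpr (Eventually.of_forall fun x hx => by
        have : 0 < x := hx
        simp only [Pi.zero_apply]; positivity)), integral_const_mul, hint]
    congr 1
    have hrefl := Real.Gamma_mul_Gamma_one_sub (1 / p)
    rw [Real.Gamma_add_one hp2.ne', one_div_one, Real.one_rpow, one_mul]
    calc _ = c ^ (-(1 / p)) * (1 / p) * (Real.Gamma (1 / p) * Real.Gamma (1 - 1 / p)) := by ring
      _ = _ := by
        rw [hrefl, mul_one_div]
        ring_nf
  · refine Measurable.aemeasurable ?_
    unfold Function.uncurry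
    fun_prop

theorem integral_div_one_add_mul_rpow_le {p c A : ℝ} (hp : 1 < p) (hc : 0 < c) (hA : 0 ≤ A)
    {t : ℝ} (ht : 0 ≤ t) :
    ∫ x in (0 : ℝ)..t, A / (1 + c * |x| ^ p) ≤
      A * c ^ (-(1 / p)) * Real.pi / (p * Real.sin (Real.pi / p)) := by
  have hp0 : 0 < p := by linarith
  have hsin : 0 ≤ Real.sin (Real.pi / p) :=
    Real.sin_nonneg_of_nonneg_of_le_pi (by positivity) (div_le_self Real.pi_pos.le hp.le)
  have key : ∫ x in (0 : ℝ)..t, 1 / (1 + c * |x| ^ p) ≤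
      c ^ (-(1 / p)) * Real.pi / (p * Real.sin (Real.pi / p)) := by
    rw [intervalIntegral.integral_of_le ht, integral_eq_lintegral_of_nonneg_ae
      (Eventually.of_forall fun x => by simp only [Pi.zero_apply]; positivity)
      (Measurable.aestronglyMeasurable (by fun_prop))]
    refine ENNReal.toReal_le_of_le_ofReal (by positivity) ?_
    rw [← lintegral_one_div_one_add_mul_rpow hp hc]
    calc ∫⁻ x in Ioc 0 t, ENNReal.ofReal (1 / (1 + c * |x| ^ p))
        = ∫⁻ x in Ioc 0 t, ENNReal.ofReal (1 / (1 + c * x ^ p)) :=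
          setLIntegral_congr_fun measurableSet_Ioc fun x hx => by
            simp only [abs_of_pos hx.1]
      _ ≤ _ := lintegral_mono_set fun x hx => hx.1
  calc ∫ x in (0 : ℝ)..t, A / (1 + c * |x| ^ p)
      = A * ∫ x in (0 : ℝ)..t, 1 / (1 + c * |x| ^ p) := by
        rw [← intervalIntegral.integral_const_mul]
        simp_rw [mul_one_div]
    _ ≤ A * (c ^ (-(1 / p)) * Real.pi / (p * Real.sin (Real.pi / p))) := by gcongr
    _ = _ := by ring

/-- A real function has null windowed Cesàro mean if, for every `ε > 0`, it is dominated on the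
blocks `[n r, (n + 1) r]` by nonnegative constants whose averages are eventually at most `ε`. -/
def CesaroNull (r : ℝ) (D : ℝ → ℝ) : Prop :=
  ∀ ε > 0, ∃ a : ℕ → ℝ, (∀ n, 0 ≤ a n) ∧
    (∀ n : ℕ, ∀ τ ∈ Icc (n * r) ((n + 1) * r), D τ ≤ a n) ∧
    ∀ᶠ N : ℕ in atTop, ∑ n ∈ Finset.range N, a n ≤ ε * N

namespace CesaroNull

variable {r : ℝ} {D E : ℝ → ℝ}

theorem mono (hr : 0 < r) (hE : CesaroNull r E) (h : ∀ t ≥ 0, D t ≤ E t) : CesaroNull r D := by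
  intro ε hε
  obtain ⟨a, ha0, haE, ha⟩ := hE ε hε
  exact ⟨a, ha0, fun n τ hτ => (h τ (le_trans (by positivity) hτ.1)).trans (haE n τ hτ), ha⟩

theorem add (hD : CesaroNull r D) (hE : CesaroNull r E) :
    CesaroNull r (fun t => D t + E t) := by
  intro ε hε
  obtain ⟨a, ha0, haD, ha⟩ := hD (ε / 2) (by positivity)
  obtain ⟨b, hb0, hbE, hb⟩ := hE (ε / 2) (by positivity)
  refine ⟨fun n => a n + b n, fun n => add_nonneg (ha0 n) (hb0 n),
    fun n τ hτ => add_le_add (haD n τ hτ) (hbE n τ hτ), ?_⟩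
  filter_upwards [ha, hb] with N h1 h2
  rw [Finset.sum_add_distrib]
  linarith

theorem const_mul (hD : CesaroNull r D) {c : ℝ} (hc : 0 ≤ c) :
    CesaroNull r (fun t => c * D t) := by
  intro ε hε
  obtain ⟨a, ha0, haD, ha⟩ := hD (ε / (c + 1)) (by positivity)
  refine ⟨fun n => c * a n, fun n => mul_nonneg hc (ha0 n),
    fun n τ hτ => mul_le_mul_of_nonneg_left (haD n τ hτ) hc, ?_⟩
  filter_upwards [ha] with N h1
  rw [← Finset.mul_sum]
  calc c * ∑ n ∈ Finset.range N, a n ≤ c * (ε / (c + 1) * N) := by gcongr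
    _ = (c / (c + 1)) * (ε * N) := by ring
    _ ≤ 1 * (ε * N) := by
        gcongr
        rw [div_le_one (by positivity)]
        linarith
    _ = ε * N := one_mul _

theorem zero : CesaroNull r (fun _ => 0) := fun ε hε =>
  ⟨fun _ => 0, fun _ => le_rfl, fun _ _ _ => le_rfl, Eventually.of_forall fun N => by
    simp only [Finset.sum_const_zero]; positivity⟩

theorem of_forall_exists_le (hr : 0 < r)
    (h : ∀ ε > 0, ∃ E, CesaroNull r E ∧ ∀ t ≥ 0, D t ≤ E t + ε) : CesaroNull r D := by
  intro ε hε
  obtain ⟨E, hE, hDE⟩ := h (ε / 2) (by positivity)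
  obtain ⟨a, ha0, haE, ha⟩ := hE (ε / 2) (by positivity)
  refine ⟨fun n => a n + ε / 2, fun n => by have := ha0 n; positivity, fun n τ hτ =>
    (hDE τ (le_trans (by positivity) hτ.1)).trans (add_le_add_left (haE n τ hτ) _), ?_⟩
  filter_upwards [ha] with N h1
  rw [Finset.sum_add_distrib, Finset.sum_const, Finset.card_range, nsmul_eq_mul]
  linarith

/-- An antitone function whose block samples have bounded partial sums is null. -/
theorem of_antitoneOn (hr : 0 < r) {k : ℝ → ℝ} {K : ℝ} (hk0 : ∀ t ≥ 0, 0 ≤ k t)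
    (hk : AntitoneOn k (Ici 0)) (hK : ∀ N : ℕ, ∑ n ∈ Finset.range N, k (n * r) ≤ K) :
    CesaroNull r k := by
  intro ε hε
  have hn : ∀ n : ℕ, (0 : ℝ) ≤ n * r := fun n => by positivity
  refine ⟨fun n => k (n * r), fun n => hk0 _ (hn n),
    fun n τ hτ => hk (hn n) ((hn n).trans hτ.1) hτ.1, ?_⟩
  filter_upwards [eventually_ge_atTop ⌈K / ε⌉₊] with N hN
  refine (hK N).trans ?_
  have := (div_le_iff₀ hε).mp (Nat.ceil_le.mp hN)
  linarith

/-- Nullity is preserved when passing to suprema over the trailing window of length `r`. -/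
theorem window (hr : 0 < r) {B : ℝ} (hB : ∀ t, D t ≤ B) (hD : CesaroNull r D)
    (hE : ∀ t ≥ 0, ∀ b ≥ 0, (∀ s ∈ Icc (t - r) t, D s ≤ b) → E t ≤ b) : CesaroNull r E := by
  intro ε hε
  obtain ⟨a, ha0, haD, ha⟩ := hD (ε / 3) (by positivity)
  refine ⟨fun n => n.casesOn (max B 0) (fun m => a m + a (m + 1)), fun n => ?_,
    fun n τ hτ => ?_, ?_⟩
  · cases n with
    | zero => exact le_max_right _ _
    | succ m => exact add_nonneg (ha0 _) (ha0 _)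
  · refine hE τ (le_trans (by positivity) hτ.1) _ ?_ ?_
    · cases n with
      | zero => exact le_max_right _ _
      | succ m => exact add_nonneg (ha0 _) (ha0 _)
    · intro s hs
      cases n with
      | zero => exact (hB s).trans (le_max_left _ _)
      | succ m =>
        have h1 := hτ.1
        have h2 := hτ.2
        push_cast at h1 h2
        rcases le_total s ((m + 1) * r) with h | h
        · exact (haD m s ⟨by linarith [hs.1], h⟩).trans (le_add_of_nonneg_right (ha0 _))
        · refine (haD (m + 1) s ⟨?_, ?_⟩).trans (le_add_of_nonneg_left (ha0 _))
          · push_cast; exact h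
          · push_cast; linarith [hs.2]
  · have hev : ∀ᶠ N : ℕ in atTop, max B 0 ≤ ε / 3 * N := by
      filter_upwards [eventually_ge_atTop ⌈max B 0 / (ε / 3)⌉₊] with N hN
      have := (div_le_iff₀ (by positivity)).mp (Nat.ceil_le.mp hN)
      linarith
    filter_upwards [ha, hev, eventually_ge_atTop 1] with N h1 h2 h3
    obtain ⟨M, rfl⟩ : ∃ M, N = M + 1 := ⟨N - 1, by omega⟩
    rw [Finset.sum_range_succ']
    simp only [Finset.sum_add_distrib]
    have e1 : ∑ n ∈ Finset.range M, a n ≤ ∑ n ∈ Finset.range (M + 1), a n := by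
      rw [Finset.sum_range_succ]
      linarith [ha0 M]
    have e2 : ∑ n ∈ Finset.range M, a (n + 1) ≤ ∑ n ∈ Finset.range (M + 1), a n := by
      rw [Finset.sum_range_succ']
      linarith [ha0 0]
    calc _ ≤ ε / 3 * (M + 1 : ℕ) + ε / 3 * (M + 1 : ℕ) + ε / 3 * (M + 1 : ℕ) :=
          add_le_add (add_le_add (e1.trans h1) (e2.trans h1)) h2
      _ = ε * (M + 1 : ℕ) := by ring

end CesaroNull

theorem sum_range_convolution_le {κ a : ℕ → ℝ} {K : ℝ} (ha : ∀ n, 0 ≤ a n)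
    (hK : ∀ N, ∑ n ∈ Finset.range N, κ n ≤ K) (N : ℕ) :
    ∑ n ∈ Finset.range N, ∑ j ∈ Finset.range (n + 1), κ (n - j) * a j ≤
      K * ∑ j ∈ Finset.range N, a j := by
  rw [Finset.sum_comm' (t' := Finset.range N) (s' := fun j => Finset.Ico j N)
    (by intro x y; simp only [Finset.mem_range, Finset.mem_Ico]; omega), Finset.mul_sum]
  refine Finset.sum_le_sum fun j _ => ?_
  rw [← Finset.sum_mul, Finset.sum_Ico_eq_sum_range]
  simp only [Nat.add_sub_cancel_left]
  exact mul_le_mul_of_nonneg_right (hK _) (ha j)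

section Convolution

variable {X : Type*} [NormedAddCommGroup X] [NormedSpace ℝ X]

/-- Convolution against a strongly continuous family with summable antitone norm bound preserves
nullity. -/
theorem CesaroNull.convolution {r K : ℝ} (hr : 0 < r) {S : ℝ → X →L[ℝ] X} {k : ℝ → ℝ}
    (hS : Continuous fun p : ℝ × X => S p.1 p.2) (hSk : ∀ t ≥ 0, ‖S t‖ ≤ k t)
    (hk : AntitoneOn k (Ici 0)) (hK : ∀ N : ℕ, ∑ n ∈ Finset.range N, k (n * r) ≤ K)
    {G : ℝ → X} (hG : Continuous G) (hGn : CesaroNull r fun t => ‖G t‖) :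
    CesaroNull r fun t => ‖∫ s in (0 : ℝ)..t, S (t - s) (G s)‖ := by
  have hk0 : ∀ t ≥ 0, 0 ≤ k t := fun t ht => (norm_nonneg _).trans (hSk t ht)
  have hn : ∀ n : ℕ, (0 : ℝ) ≤ n * r := fun n => by positivity
  set κ : ℕ → ℝ := fun n => n.casesOn (k 0) (fun m => k (m * r)) with hκ
  have hκ0 : ∀ n, 0 ≤ κ n := fun n => by
    cases n with
    | zero => exact hk0 0 le_rfl
    | succ m => exact hk0 _ (hn m)
  have hκK : ∀ N, ∑ n ∈ Finset.range N, κ n ≤ K + k 0 := fun N => by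
    cases N with
    | zero =>
      have := hK 0
      simp only [Finset.range_zero, Finset.sum_empty] at this ⊢
      exact add_nonneg this (hk0 0 le_rfl)
    | succ M =>
      rw [Finset.sum_range_succ']
      exact add_le_add (hK M) le_rfl
  have hK0 : 0 ≤ K + k 0 := by simpa using hκK 0
  have hle : ∀ d : ℕ, ∀ t ≥ 0, (d - 1 : ℝ) * r ≤ t → k t ≤ κ d := fun d t ht hdt => by
    cases d with
    | zero => exact hk (mem_Ici.mpr le_rfl) ht ht
    | succ m =>
      push_cast at hdt
      exact hk (hn m) ht (by linarith)
  intro ε hε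
  obtain ⟨a, ha0, haG, ha⟩ := hGn (ε / (r * (K + k 0 + 1))) (by positivity)
  refine ⟨fun n => r * ∑ j ∈ Finset.range (n + 1), κ (n - j) * a j, fun n =>
    mul_nonneg hr.le (Finset.sum_nonneg fun j _ => mul_nonneg (hκ0 _) (ha0 _)),
    fun n t ht => ?_, ?_⟩
  · have hcont : Continuous fun s => S (t - s) (G s) :=
      hS.comp ((continuous_const.sub continuous_id).prodMk hG)
    have hint : ∀ x y, IntervalIntegrable (fun s => S (t - s) (G s)) volume x y :=
      fun x y => hcont.intervalIntegrable x y
    have hpt : ∀ j : ℕ, j ≤ n → ∀ s ∈ Icc (j * r) ((j + 1) * r), s ≤ t →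
        ‖S (t - s) (G s)‖ ≤ κ (n - j) * a j := fun j hj s hs hst => by
      refine ((S (t - s)).le_opNorm _).trans (mul_le_mul ?_ (haG j s hs) (norm_nonneg _) (hκ0 _))
      refine (hSk _ (by linarith)).trans (hle _ _ (by linarith) ?_)
      rw [Nat.cast_sub hj]
      nlinarith [ht.1, hs.2]
    have hsplit : ∫ s in (0 : ℝ)..t, S (t - s) (G s) =
        (∑ j ∈ Finset.range n, ∫ s in (j * r : ℝ)..((j + 1 : ℕ) * r : ℝ), S (t - s) (G s)) +
          ∫ s in (n * r : ℝ)..t, S (t - s) (G s) := by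
      rw [intervalIntegral.sum_integral_adjacent_intervals (a := fun j : ℕ => (j * r : ℝ))
        (fun j _ => hint _ _)]
      rw [intervalIntegral.integral_add_adjacent_intervals (hint _ _) (hint _ _)]
      simp
    simp only [hsplit]
    rw [Finset.sum_range_succ, mul_add, Finset.mul_sum]
    refine (norm_add_le _ _).trans (add_le_add ((norm_sum_le _ _).trans
      (Finset.sum_le_sum fun j hj => ?_)) ?_)
    · have hjn : j < n := Finset.mem_range.mp hj
      have hjn' : ((j + 1 : ℕ) : ℝ) * r ≤ t := by
        refine le_trans ?_ ht.1
        gcongr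
        omega
      have hjj : (j * r : ℝ) ≤ ((j + 1 : ℕ) : ℝ) * r := by gcongr; omega
      refine (intervalIntegral.norm_integral_le_of_norm_le_const (C := κ (n - j) * a j)
        fun s hs => ?_).trans (le_of_eq ?_)
      · rw [uIoc_of_le hjj] at hs
        refine hpt j hjn.le s ⟨hs.1.le, ?_⟩ (hs.2.trans hjn')
        simpa using hs.2
      · rw [abs_of_nonneg (sub_nonneg.mpr hjj)]
        push_cast
        ring
    · refine (intervalIntegral.norm_integral_le_of_norm_le_const (C := κ (n - n) * a n)
        fun s hs => ?_).trans ?_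
      · rw [uIoc_of_le ht.1] at hs
        exact hpt n le_rfl s ⟨hs.1.le, hs.2.trans ht.2⟩ hs.2
      · rw [mul_comm r]
        refine mul_le_mul_of_nonneg_left ?_ (mul_nonneg (hκ0 _) (ha0 _))
        rw [abs_of_nonneg (sub_nonneg.mpr ht.1)]
        linarith [ht.2]
  · filter_upwards [ha] with N hN
    rw [← Finset.mul_sum]
    calc r * ∑ n ∈ Finset.range N, ∑ j ∈ Finset.range (n + 1), κ (n - j) * a j
        ≤ r * ((K + k 0) * (ε / (r * (K + k 0 + 1)) * N)) := by
          gcongr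
          exact (sum_range_convolution_le ha0 hκK N).trans (by gcongr)
      _ = (K + k 0) / (K + k 0 + 1) * (ε * N) := by field_simp
      _ ≤ 1 * (ε * N) := by
          gcongr
          rw [div_le_one (by positivity)]
          linarith
      _ = ε * N := one_mul _

end Convolution

/-- Uniform pseudo S-asymptotic periodicity controls the increments along any bounded curve. -/
theorem PSAPunif.cesaroNull {E Y : Type*} [NormedAddCommGroup E] [NormedAddCommGroup Y]
    {ω r B L : ℝ} (hr : 0 < r) (hω : 0 < ω) {F : ℝ → E → Y} (hF : PSAPunif ω r F)
    (hc : ContinuousOn (fun p : ℝ × E => F p.1 p.2) (Ici 0 ×ˢ univ)) (hL : 0 < L)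
    (hB : ∀ t ≥ 0, ∀ x, ‖x‖ ≤ L → ‖F t x‖ ≤ B) {y : ℝ → E} (hy : ∀ t ≥ 0, ‖y t‖ ≤ L) :
    CesaroNull r fun t => ‖F (t + ω) (y t) - F t (y t)‖ := by
  set q : ℝ → E → ℝ := fun τ x => ‖F (τ + ω) x - F τ x‖ with hq
  have hB0 : 0 ≤ B := (norm_nonneg _).trans (hB 0 le_rfl (y 0) (hy 0 le_rfl))
  have hqB : ∀ τ ≥ 0, ∀ x, ‖x‖ ≤ L → q τ x ≤ 2 * B := fun τ hτ x hx => by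
    refine (norm_sub_le _ _).trans ?_
    linarith [hB (τ + ω) (by linarith) x hx, hB τ hτ x hx]
  have hqc : ∀ x, ContinuousOn (fun τ => q τ x) (Ici 0) := fun x => by
    refine (ContinuousOn.sub ?_ ?_).norm
    · exact hc.comp (f := fun τ : ℝ => (τ + ω, x)) (by fun_prop) fun τ hτ => ⟨by
        have : 0 ≤ τ := hτ
        simp only [mem_Ici]
        linarith, mem_univ _⟩
    · exact hc.comp (f := fun τ : ℝ => (τ, x)) (by fun_prop) fun τ hτ => ⟨hτ, mem_univ _⟩
  set H : ℝ → ℝ := fun s => ⨆ τ ∈ Icc (s - r) s, ⨆ x ∈ {x : E | ‖x‖ ≤ L}, q τ x with hH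
  have hin0 : ∀ τ, 0 ≤ ⨆ x ∈ {x : E | ‖x‖ ≤ L}, q τ x := fun τ =>
    Real.iSup_nonneg fun x => Real.iSup_nonneg fun _ => norm_nonneg _
  have hinB : ∀ τ ≥ 0, ⨆ x ∈ {x : E | ‖x‖ ≤ L}, q τ x ≤ 2 * B := fun τ hτ =>
    Real.iSup_le (fun x => Real.iSup_le (fun hx => hqB τ hτ x hx) (by positivity)) (by positivity)
  have hH0 : ∀ s, 0 ≤ H s := fun s => Real.iSup_nonneg fun τ => Real.iSup_nonneg fun _ => hin0 τ
  have hHB : ∀ s ≥ r, H s ≤ 2 * B := fun s hs =>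
    Real.iSup_le (fun τ => Real.iSup_le (fun hτ => hinB τ (by linarith [hτ.1])) (by positivity))
      (by positivity)
  have hle : ∀ s ≥ r, ∀ τ ∈ Icc (s - r) s, ∀ x, ‖x‖ ≤ L → q τ x ≤ H s := fun s hs τ hτ x hx => by
    have h1 : q τ x ≤ ⨆ x ∈ {x : E | ‖x‖ ≤ L}, q τ x := by
      refine le_ciSup_of_le ⟨2 * B, ?_⟩ x ?_
      · rintro _ ⟨x', rfl⟩
        exact Real.iSup_le (fun hx' => hqB τ (by linarith [hτ.1]) x' hx') (by positivity)
      · rw [ciSup_pos (show x ∈ {x : E | ‖x‖ ≤ L} from hx)]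
    refine h1.trans (le_ciSup_of_le ⟨2 * B, ?_⟩ τ ?_)
    · rintro _ ⟨τ', rfl⟩
      exact Real.iSup_le (fun hτ' => hinB τ' (by linarith [hτ'.1])) (by positivity)
    · rw [ciSup_pos hτ]
  have hex : ∀ c ≥ 0, ∀ s, c < H s → ∃ τ ∈ Icc (s - r) s, ∃ x, ‖x‖ ≤ L ∧ c < q τ x := by
    intro c hc0 s hs
    by_contra! hcon
    exact absurd hs (not_lt.mpr (Real.iSup_le (fun τ => Real.iSup_le (fun hτ => Real.iSup_le
      (fun x => Real.iSup_le (fun hx => hcon τ hτ x hx) hc0) hc0) hc0) hc0))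
  have hmeas : Measurable ((Ioi r).indicator H) := by
    refine measurable_of_Ioi fun c => ?_
    rcases lt_or_ge c 0 with hc0 | hc0
    · have : (Ioi r).indicator H ⁻¹' Ioi c = univ := by
        ext s
        simp only [mem_preimage, mem_Ioi, mem_univ, iff_true]
        exact hc0.trans_le (indicator_nonneg (fun s _ => hH0 s) s)
      rw [this]
      exact MeasurableSet.univ
    · have : (Ioi r).indicator H ⁻¹' Ioi c = {s | r < s ∧ c < H s} := by
        ext s
        simp only [mem_preimage, mem_Ioi, mem_ofPred_eq, indicator_apply]
        split_ifs with h
        · simp [h]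
        · simp [h, hc0]
      rw [this]
      refine IsOpen.measurableSet (isOpen_iff_mem_nhds.mpr ?_)
      rintro s₀ ⟨hs₀, hcs₀⟩
      obtain ⟨τ₀, hτ₀, x, hx, hcx⟩ := hex c hc0 s₀ hcs₀
      have hτpos : 0 < τ₀ := by linarith [hτ₀.1]
      have hcat : ContinuousAt (fun τ => q τ x) τ₀ := (hqc x).continuousAt (Ici_mem_nhds hτpos)
      have hshift : Tendsto (fun s : ℝ => τ₀ + (s - s₀)) (nhds s₀) (nhds τ₀) := by
        have : Continuous fun s : ℝ => τ₀ + (s - s₀) := by fun_prop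
        simpa using this.tendsto s₀
      filter_upwards [hshift.eventually (hcat.eventually (lt_mem_nhds hcx)), Ioi_mem_nhds hs₀]
        with s hs1 hs2
      exact ⟨hs2, hs1.trans_le (hle s (le_of_lt hs2) _
        ⟨by linarith [hτ₀.1], by linarith [hτ₀.2]⟩ x hx)⟩
  have hint : ∀ a b, r ≤ a → r ≤ b → IntervalIntegrable H volume a b := by
    intro a b ha hb
    have h1 : IntervalIntegrable ((Ioi r).indicator H) volume a b := by
      refine (intervalIntegrable_const (c := 2 * B)).mono_fun hmeas.aestronglyMeasurable
        (Eventually.of_forall fun s => ?_)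
      beta_reduce
      rw [Real.norm_of_nonneg (indicator_nonneg (fun s _ => hH0 s) s),
        Real.norm_of_nonneg (by positivity), indicator_apply]
      split_ifs with h
      · exact hHB s (le_of_lt h)
      · positivity
    refine h1.congr fun s hs => indicator_of_mem ?_ H
    have : r ≤ min a b := le_min ha hb
    exact this.trans_lt hs.1
  have hrn : ∀ n : ℕ, r ≤ ((n : ℝ) + 1) * r := fun n => by nlinarith [n.cast_nonneg (α := ℝ)]
  set I : ℕ → ℝ := fun n => ∫ s in r..((n : ℝ) + 1) * r, H s with hI
  have hI0 : ∀ n, 0 ≤ I n := fun n =>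
    intervalIntegral.integral_nonneg (hrn n) fun s _ => hH0 s
  have hIdiff : ∀ n, I (n + 2) - I n =
      ∫ s in ((n : ℝ) + 1) * r..((n : ℝ) + 3) * r, H s := fun n => by
    have h3 := hrn (n + 2)
    simp only [hI]
    push_cast at h3 ⊢
    rw [show (n : ℝ) + 2 + 1 = n + 3 by ring] at *
    rw [sub_eq_iff_eq_add', intervalIntegral.integral_add_adjacent_intervals
      (hint _ _ le_rfl (hrn n)) (hint _ _ (hrn n) h3)]
  have hsum : ∀ M : ℕ, ∑ n ∈ Finset.range M, (I (n + 2) - I n) = I (M + 1) + I M - I 1 - I 0 := by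
    intro M
    induction M with
    | zero => simp
    | succ M ih => rw [Finset.sum_range_succ, ih]; ring
  intro ε hε
  refine ⟨fun n => n.casesOn (2 * B) fun m => (I (m + 2) - I m) / r, fun n => ?_,
    fun n τ hτ => ?_, ?_⟩
  · cases n with
    | zero => exact mul_nonneg zero_le_two hB0
    | succ m =>
      simp only [hIdiff]
      exact div_nonneg (intervalIntegral.integral_nonneg (by nlinarith) fun s _ => hH0 s) hr.le
  · have hτ0 : 0 ≤ τ := le_trans (by positivity) hτ.1
    cases n with
    | zero => exact hqB τ hτ0 _ (hy τ hτ0)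
    | succ m =>
      have h1 := hτ.1
      have h2 := hτ.2
      push_cast at h1 h2
      have h0 := hrn m
      simp only [hIdiff]
      rw [le_div_iff₀ hr]
      calc q τ (y τ) * r = ∫ _ in τ..τ + r, q τ (y τ) := by
            rw [intervalIntegral.integral_const, smul_eq_mul]; ring
        _ ≤ ∫ s in τ..τ + r, H s := by
            refine intervalIntegral.integral_mono_on (by linarith) intervalIntegrable_const
              (hint _ _ (by linarith) (by linarith)) fun s hs => ?_
            exact hle s (by linarith [hs.1]) τ ⟨by linarith [hs.2], hs.1⟩ _ (hy τ hτ0)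
        _ ≤ ∫ s in ((m : ℝ) + 1) * r..((m : ℝ) + 3) * r, H s :=
            intervalIntegral.integral_mono_interval (by linarith) (by linarith) (by linarith)
              (Eventually.of_forall hH0) (hint _ _ h0 (by linarith))
  · have hlim := (hF L hL).eventually (gt_mem_nhds (show 0 < ε / 8 by positivity))
    have hT : Tendsto (fun n : ℕ => ((n : ℝ) + 1) * r) atTop atTop :=
      (tendsto_natCast_atTop_atTop.atTop_add tendsto_const_nhds).atTop_mul_const hr
    have hev : ∀ᶠ n : ℕ in atTop, I n ≤ ε / 8 * (((n : ℝ) + 1) * r) := by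
      filter_upwards [hT.eventually hlim] with n hn
      have hpos : 0 < ((n : ℝ) + 1) * r := by positivity
      have hn' : 1 / (((n : ℝ) + 1) * r) * I n < ε / 8 := hn
      rw [one_div, inv_mul_lt_iff₀ hpos] at hn'
      linarith
    have hB' : ∀ᶠ N : ℕ in atTop, 2 * B ≤ ε / 4 * N := by
      filter_upwards [eventually_ge_atTop ⌈2 * B / (ε / 4)⌉₊] with N hN
      have := (div_le_iff₀ (by positivity)).mp (Nat.ceil_le.mp hN)
      linarith
    obtain ⟨N₀, hN₀⟩ := eventually_atTop.mp hev
    filter_upwards [hB', eventually_ge_atTop (N₀ + 2)] with N h1 h2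
    obtain ⟨M, rfl⟩ : ∃ M, N = M + 1 := ⟨N - 1, by omega⟩
    rw [Finset.sum_range_succ']
    simp only []
    rw [← Finset.sum_div, hsum]
    have e1 := hN₀ M (by omega)
    have e2 := hN₀ (M + 1) (by omega)
    push_cast at e2 h1 ⊢
    have hM : (1 : ℝ) ≤ M := by exact_mod_cast (by omega : 1 ≤ M)
    have : (I (M + 1) + I M - I 1 - I 0) / r ≤ ε / 8 * (2 * M + 3) := by
      rw [div_le_iff₀ hr]
      nlinarith [hI0 0, hI0 1]
    have h5 : ε * 1 ≤ ε * M := by gcongr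
    calc _ ≤ ε / 8 * (2 * M + 3) + ε / 4 * (M + 1) := add_le_add this h1
      _ ≤ ε * (M + 1) := by linarith

/-- Nullity of the increments gives pseudo S-asymptotic periodicity. -/
theorem CesaroNull.psapClass {Y : Type*} [NormedAddCommGroup Y] {ω r : ℝ} (hr : 0 < r)
    {u : ℝ → Y} (h : CesaroNull r fun t => ‖u (t + ω) - u t‖) : PSAPclass ω r u := by
  refine Metric.tendsto_nhds.mpr fun ε hε => ?_
  obtain ⟨a, ha0, hau, ha⟩ := h (ε / 7) (by positivity)
  set b : ℝ → ℝ := fun s => a (⌈s / r⌉₊ - 1) + a (⌈s / r⌉₊ - 2) with hb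
  have hceil : ∀ n : ℕ, ∀ s ∈ Ioc ((n : ℝ) * r) (((n + 1 : ℕ) : ℝ) * r), ⌈s / r⌉₊ = n + 1 := by
    intro n s hs
    rw [Nat.ceil_eq_iff (by omega)]
    constructor
    · rw [lt_div_iff₀ hr]; simpa using hs.1
    · rw [div_le_iff₀ hr]; exact hs.2
  have hle : ∀ n : ℕ, (n : ℝ) * r ≤ ((n + 1 : ℕ) : ℝ) * r := fun n => by gcongr; omega
  have hbn : ∀ n : ℕ, EqOn (fun _ => a n + a (n - 1)) b
      (Set.uIoc ((n : ℝ) * r) (((n + 1 : ℕ) : ℝ) * r)) := fun n s hs => by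
    rw [uIoc_of_le (hle n)] at hs
    simp only [hb, hceil n s hs]
    rfl
  have hbint : ∀ n : ℕ, IntervalIntegrable b volume ((n : ℝ) * r) (((n + 1 : ℕ) : ℝ) * r) :=
    fun n => intervalIntegrable_const.congr (hbn n)
  have hbintN : ∀ N : ℕ, IntervalIntegrable b volume 0 ((N : ℝ) * r) := fun N => by
    simpa using IntervalIntegrable.trans_iterate (a := fun n : ℕ => (n : ℝ) * r) (n := N)
      fun k _ => hbint k
  have hbN : ∀ N : ℕ, ∫ s in (0 : ℝ)..N * r, b s =
      r * ∑ n ∈ Finset.range N, (a n + a (n - 1)) := fun N => by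
    have := intervalIntegral.sum_integral_adjacent_intervals
      (a := fun n : ℕ => (n : ℝ) * r) (n := N) fun k _ => hbint k
    simp only [Nat.cast_zero, zero_mul] at this
    rw [← this, Finset.mul_sum]
    refine Finset.sum_congr rfl fun n _ => ?_
    rw [← intervalIntegral.integral_congr_ae (Eventually.of_forall (hbn n)), intervalIntegral.integral_const, smul_eq_mul]
    push_cast
    ring
  have hsum : ∀ N : ℕ, ∑ n ∈ Finset.range N, (a n + a (n - 1)) ≤
      3 * ∑ n ∈ Finset.range N, a n := fun N => by
    cases N with
    | zero => simp
    | succ M =>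
      have e0 : a 0 ≤ ∑ n ∈ Finset.range (M + 1), a n :=
        Finset.single_le_sum (fun n _ => ha0 n) (Finset.mem_range.mpr M.succ_pos)
      have e1 : ∑ n ∈ Finset.range M, a n ≤ ∑ n ∈ Finset.range (M + 1), a n := by
        rw [Finset.sum_range_succ]
        linarith [ha0 M]
      rw [Finset.sum_add_distrib, Finset.sum_range_succ' (fun n => a (n - 1))]
      simp only [Nat.add_sub_cancel, Nat.zero_sub]
      linarith
  have hceilT : Tendsto (fun T : ℝ => ⌈T / r⌉₊) atTop atTop :=
    tendsto_nat_ceil_atTop.comp (tendsto_id.atTop_div_const hr)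
  filter_upwards [hceilT.eventually ha, eventually_ge_atTop r] with T hT hrT
  have hT0 : 0 < T := hr.trans_le hrT
  have hH0 : ∀ s, 0 ≤ ⨆ τ ∈ Icc (s - r) s, ‖u (τ + ω) - u τ‖ := fun s =>
    Real.iSup_nonneg fun τ => Real.iSup_nonneg fun _ => norm_nonneg _
  have hTN : T ≤ ⌈T / r⌉₊ * r := (div_le_iff₀ hr).mp (Nat.le_ceil _)
  have hNT : ⌈T / r⌉₊ * r ≤ 2 * T := by
    have := (Nat.ceil_lt_add_one (show 0 ≤ T / r by positivity)).le
    calc ⌈T / r⌉₊ * r ≤ (T / r + 1) * r := by gcongr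
      _ = T + r := by field_simp
      _ ≤ 2 * T := by linarith
  have hHb : ∀ s ∈ Ioc r T, ⨆ τ ∈ Icc (s - r) s, ‖u (τ + ω) - u τ‖ ≤ b s := by
    intro s hs
    have hb0 : 0 ≤ b s := add_nonneg (ha0 _) (ha0 _)
    refine Real.iSup_le (fun τ => Real.iSup_le (fun hτ => ?_) hb0) hb0
    have hc2 : 2 ≤ ⌈s / r⌉₊ := by
      have : 1 < ⌈s / r⌉₊ := Nat.lt_ceil.mpr (by rw [lt_div_iff₀ hr]; simpa using hs.1)
      omega
    obtain ⟨m, hm⟩ : ∃ m, ⌈s / r⌉₊ = m + 2 := ⟨⌈s / r⌉₊ - 2, by omega⟩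
    have hm' := (Nat.ceil_eq_iff (by omega)).mp hm
    rw [lt_div_iff₀ hr, div_le_iff₀ hr] at hm'
    obtain ⟨hm1, hm2⟩ := hm'
    simp only [Nat.add_succ_sub_one, Nat.cast_add, Nat.cast_one, Nat.cast_ofNat] at hm1 hm2
    simp only [hb, hm, Nat.add_sub_cancel, Nat.add_succ_sub_one]
    rcases le_total τ ((m + 1) * r) with hτm | hτm
    · exact (hau m τ ⟨by linarith [hτ.1], hτm⟩).trans (le_add_of_nonneg_left (ha0 _))
    · refine (hau (m + 1) τ ⟨?_, ?_⟩).trans (le_add_of_nonneg_right (ha0 _))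
      · push_cast; exact hτm
      · push_cast; linarith [hτ.2]
  have hb0 : ∀ s, 0 ≤ b s := fun s => add_nonneg (ha0 _) (ha0 _)
  have hbrT : IntervalIntegrable b volume r T := (hbintN ⌈T / r⌉₊).mono_set (by
    rw [uIcc_of_le hrT, uIcc_of_le (hT0.le.trans hTN)]
    exact Icc_subset_Icc hr.le hTN)
  have hI : ∫ s in r..T, ⨆ τ ∈ Icc (s - r) s, ‖u (τ + ω) - u τ‖ ≤ ∫ s in r..T, b s := by
    rw [intervalIntegral.integral_of_le hrT, intervalIntegral.integral_of_le hrT]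
    exact integral_mono_of_nonneg (Eventually.of_forall hH0)
      ((intervalIntegrable_iff_integrableOn_Ioc_of_le hrT).mp hbrT)
      ((ae_restrict_iff' measurableSet_Ioc).mpr (Eventually.of_forall hHb))
  have hI2 : ∫ s in r..T, b s ≤ ∫ s in (0 : ℝ)..⌈T / r⌉₊ * r, b s :=
    intervalIntegral.integral_mono_interval hr.le hrT hTN (Eventually.of_forall hb0) (hbintN _)
  have hfin : ∫ s in r..T, ⨆ τ ∈ Icc (s - r) s, ‖u (τ + ω) - u τ‖ ≤ 6 * (ε / 7) * T := by
    calc _ ≤ r * ∑ n ∈ Finset.range ⌈T / r⌉₊, (a n + a (n - 1)) := (hI.trans hI2).trans (hbN _).le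
      _ ≤ r * (3 * (ε / 7 * ⌈T / r⌉₊)) := by
          gcongr
          exact (hsum _).trans (by gcongr)
      _ = 3 * (ε / 7) * (⌈T / r⌉₊ * r) := by ring
      _ ≤ 3 * (ε / 7) * (2 * T) := by gcongr
      _ = _ := by ring
  have hnn : 0 ≤ ∫ s in r..T, ⨆ τ ∈ Icc (s - r) s, ‖u (τ + ω) - u τ‖ :=
    intervalIntegral.integral_nonneg hrT fun s _ => hH0 s
  rw [Real.dist_eq, sub_zero, abs_of_nonneg (by positivity), one_div, inv_mul_lt_iff₀ hT0]
  refine hfin.trans_lt ?_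
  nlinarith

section History

variable {X : Type*} [NormedAddCommGroup X] {r : ℝ}

theorem hist_apply {u : ℝ → X} (hu : Continuous u) (t : ℝ) (θ : Icc (-r) (0 : ℝ)) :
    hist r u t θ = u (t + θ) := by
  have h : Continuous fun θ : Icc (-r) (0 : ℝ) => u (t + θ) := by fun_prop
  rw [hist, dif_pos h]
  rfl

theorem hist_congr {u v : ℝ → X} {t : ℝ} (h : ∀ θ : Icc (-r) (0 : ℝ), u (t + θ) = v (t + θ)) :
    hist r u t = hist r v t := by
  have : (fun θ : Icc (-r) (0 : ℝ) => u (t + θ)) =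
      fun θ : Icc (-r) (0 : ℝ) => v (t + θ) := funext h
  unfold hist
  by_cases hv : Continuous fun θ : Icc (-r) (0 : ℝ) => v (t + θ)
  · rw [dif_pos (this ▸ hv), dif_pos hv]
    ext θ
    exact h θ
  · rw [dif_neg (this ▸ hv), dif_neg hv]

theorem continuous_hist {u : ℝ → X} (hu : Continuous u) : Continuous (hist r u) := by
  refine ContinuousMap.continuous_of_continuous_uncurry _ ?_
  have : (Function.uncurry fun t (θ : Icc (-r) (0 : ℝ)) => hist r u t θ) =
      fun p : ℝ × Icc (-r) (0 : ℝ) => u (p.1 + p.2) := by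
    ext ⟨t, θ⟩
    exact hist_apply hu t θ
  rw [this]
  fun_prop

theorem norm_hist_le {u : ℝ → X} (hu : Continuous u) {B : ℝ} (hB0 : 0 ≤ B)
    (hB : ∀ s, ‖u s‖ ≤ B) (t : ℝ) : ‖hist r u t‖ ≤ B :=
  (ContinuousMap.norm_le _ hB0).mpr fun θ => by rw [hist_apply hu]; exact hB _

theorem norm_hist_sub_le {u v : ℝ → X} (hu : Continuous u) (hv : Continuous v) {s t B : ℝ}
    (hB0 : 0 ≤ B) (hB : ∀ θ ∈ Icc (-r) (0 : ℝ), ‖u (s + θ) - v (t + θ)‖ ≤ B) :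
    ‖hist r u s - hist r v t‖ ≤ B :=
  (ContinuousMap.norm_le _ hB0).mpr fun θ => by
    rw [ContinuousMap.sub_apply, hist_apply hu, hist_apply hv]
    exact hB θ θ.2

open scoped BoundedContinuousFunction in
theorem isClosed_cesaroNull {ω : ℝ} (hr : 0 < r) :
    IsClosed {u : ℝ →ᵇ X | CesaroNull r fun t => ‖u (t + ω) - u t‖} := by
  refine isClosed_of_closure_subset fun u hu => ?_
  refine CesaroNull.of_forall_exists_le hr fun ε hε => ?_
  obtain ⟨v, hv, huv⟩ := Metric.mem_closure_iff.mp hu (ε / 2) (by positivity)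
  refine ⟨_, hv, fun t _ => ?_⟩
  have hd : ∀ s, ‖u s - v s‖ ≤ ε / 2 := fun s => by
    rw [← dist_eq_norm]
    exact (BoundedContinuousFunction.dist_coe_le_dist s).trans huv.le
  calc ‖u (t + ω) - u t‖ = ‖(v (t + ω) - v t) + (u (t + ω) - v (t + ω)) - (u t - v t)‖ := by
        congr 1; abel
    _ ≤ ‖v (t + ω) - v t‖ + ‖u (t + ω) - v (t + ω)‖ + ‖u t - v t‖ :=
        (norm_sub_le _ _).trans (add_le_add (norm_add_le _ _) le_rfl)
    _ ≤ ‖v (t + ω) - v t‖ + ε := by linarith [hd t, hd (t + ω)]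

end History

section Mild

variable {X : Type*} [NormedAddCommGroup X] [NormedSpace ℝ X]

open scoped BoundedContinuousFunction

/-- The right-hand side of the mild solution equation with initial vector `x`. -/
noncomputable def mildRhs (r : ℝ) (S : ℝ → X →L[ℝ] X) (g f : ℝ → C(Icc (-r) (0 : ℝ), X) → X)
    (x : X) (u : ℝ → X) (t : ℝ) : X :=
  S t x + g t (hist r u t) + ∫ s in (0 : ℝ)..t, S (t - s) (f s (hist r u s))

/-- The hypotheses on the resolvent family and the nonlinearities that drive the fixed point
argument, with all data jointly continuous on the whole line. -/
structure MildData (r ω : ℝ) (S : ℝ → X →L[ℝ] X) (g f : ℝ → C(Icc (-r) (0 : ℝ), X) → X)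
    (k : ℝ → ℝ) (K J bg bf lg lf : ℝ) : Prop where
  r_pos : 0 < r
  ω_pos : 0 < ω
  S_cont : Continuous fun p : ℝ × X => S p.1 p.2
  S_zero : S 0 = 1
  S_le : ∀ t ≥ 0, ‖S t‖ ≤ k t
  k_cont : Continuous k
  k_anti : AntitoneOn k (Ici 0)
  k_sum : ∀ N : ℕ, ∑ n ∈ Finset.range N, k (n * r) ≤ K
  k_int : ∀ t ≥ 0, ∫ s in (0 : ℝ)..t, k s ≤ J
  g_cont : Continuous fun p : ℝ × C(Icc (-r) (0 : ℝ), X) => g p.1 p.2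
  f_cont : Continuous fun p : ℝ × C(Icc (-r) (0 : ℝ), X) => f p.1 p.2
  g_zero : ∀ t ≥ 0, ‖g t 0‖ ≤ bg
  f_zero : ∀ t ≥ 0, ‖f t 0‖ ≤ bf
  lg_nonneg : 0 ≤ lg
  lf_nonneg : 0 ≤ lf
  g_lip : ∀ t ≥ 0, ∀ y z, ‖g t y - g t z‖ ≤ lg * ‖y - z‖
  f_lip : ∀ t ≥ 0, ∀ y z, ‖f t y - f t z‖ ≤ lf * ‖y - z‖
  g_null : ∀ L > 0, ∀ y : ℝ → C(Icc (-r) (0 : ℝ), X), (∀ t ≥ 0, ‖y t‖ ≤ L) →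
    CesaroNull r fun t => ‖g (t + ω) (y t) - g t (y t)‖
  f_null : ∀ L > 0, ∀ y : ℝ → C(Icc (-r) (0 : ℝ), X), (∀ t ≥ 0, ‖y t‖ ≤ L) →
    CesaroNull r fun t => ‖f (t + ω) (y t) - f t (y t)‖
  small : lg + lf * J < 1

namespace MildData

variable {r ω : ℝ} {S : ℝ → X →L[ℝ] X} {g f : ℝ → C(Icc (-r) (0 : ℝ), X) → X}
  {k : ℝ → ℝ} {K J bg bf lg lf : ℝ}

theorem k_nonneg (h : MildData r ω S g f k K J bg bf lg lf) {t : ℝ} (ht : 0 ≤ t) : 0 ≤ k t :=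
  (norm_nonneg _).trans (h.S_le t ht)

theorem J_nonneg (h : MildData r ω S g f k K J bg bf lg lf) : 0 ≤ J := by
  simpa using h.k_int 0 le_rfl

theorem continuous_forcing (h : MildData r ω S g f k K J bg bf lg lf) {u : ℝ → X}
    (hu : Continuous u) : Continuous fun s => f s (hist r u s) :=
  h.f_cont.comp (continuous_id.prodMk (continuous_hist hu))

theorem continuous_integrand (h : MildData r ω S g f k K J bg bf lg lf) {G : ℝ → X}
    (hG : Continuous G) (t : ℝ) : Continuous fun s => S (t - s) (G s) :=
  h.S_cont.comp ((continuous_const.sub continuous_id).prodMk hG)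

theorem norm_convolution_le (h : MildData r ω S g f k K J bg bf lg lf) {G : ℝ → X} {c t : ℝ}
    (hc : 0 ≤ c) (hG : ∀ s ≥ 0, ‖G s‖ ≤ c) (ht : 0 ≤ t) :
    ‖∫ s in (0 : ℝ)..t, S (t - s) (G s)‖ ≤ c * J := by
  calc ‖∫ s in (0 : ℝ)..t, S (t - s) (G s)‖ ≤ ∫ s in (0 : ℝ)..t, c * k (t - s) := by
        refine intervalIntegral.norm_integral_le_of_norm_le ht
          (Eventually.of_forall fun s hs => ?_) (Continuous.intervalIntegrable ?_ _ _)
        · rw [mul_comm]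
          have hts : 0 ≤ t - s := by linarith [hs.2]
          exact ((S (t - s)).le_opNorm _).trans (mul_le_mul (h.S_le _ hts) (hG s hs.1.le)
            (norm_nonneg _) (h.k_nonneg hts))
        · exact continuous_const.mul (h.k_cont.comp (continuous_const.sub continuous_id))
    _ = c * ∫ s in (0 : ℝ)..t, k s := by
        rw [intervalIntegral.integral_const_mul, intervalIntegral.integral_comp_sub_left]
        simp
    _ ≤ c * J := mul_le_mul_of_nonneg_left (h.k_int t ht) hc

theorem continuous_mildRhs (h : MildData r ω S g f k K J bg bf lg lf) {u : ℝ → X}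
    (hu : Continuous u) (x : X) : Continuous (mildRhs r S g f x u) := by
  refine ((h.S_cont.comp (continuous_id.prodMk continuous_const)).add
    (h.g_cont.comp (continuous_id.prodMk (continuous_hist hu)))).add ?_
  refine intervalIntegral.continuous_parametric_intervalIntegral_of_continuous
    (f := fun t s => S (t - s) (f s (hist r u s))) ?_ continuous_id
  exact h.S_cont.comp ((continuous_fst.sub continuous_snd).prodMk
    ((h.continuous_forcing hu).comp continuous_snd))

theorem norm_forcing_le (h : MildData r ω S g f k K J bg bf lg lf) (u : ℝ →ᵇ X) {t : ℝ}
    (ht : 0 ≤ t) : ‖f t (hist r u t)‖ ≤ bf + lf * ‖u‖ := by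
  have h1 := h.f_lip t ht (hist r u t) 0
  rw [sub_zero] at h1
  have h2 : lf * ‖hist r u t‖ ≤ lf * ‖u‖ := mul_le_mul_of_nonneg_left
    (norm_hist_le u.continuous (norm_nonneg _) u.norm_coe_le_norm t) h.lf_nonneg
  have h3 := norm_le_insert' (f t (hist r u t)) (f t 0)
  linarith [h.f_zero t ht]

theorem norm_mildRhs_le (h : MildData r ω S g f k K J bg bf lg lf) (u : ℝ →ᵇ X) (x : X) {t : ℝ}
    (ht : 0 ≤ t) :
    ‖mildRhs r S g f x u t‖ ≤ k 0 * ‖x‖ + (bg + lg * ‖u‖) + (bf + lf * ‖u‖) * J := by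
  refine (norm_add₃_le).trans (add_le_add (add_le_add ?_ ?_) ?_)
  · exact ((S t).le_opNorm x).trans (mul_le_mul_of_nonneg_right
      ((h.S_le t ht).trans (h.k_anti (mem_Ici.mpr le_rfl) ht ht)) (norm_nonneg _))
  · have h1 := h.g_lip t ht (hist r u t) 0
    rw [sub_zero] at h1
    have h2 : lg * ‖hist r u t‖ ≤ lg * ‖u‖ := mul_le_mul_of_nonneg_left
      (norm_hist_le u.continuous (norm_nonneg _) u.norm_coe_le_norm t) h.lg_nonneg
    have h3 := norm_le_insert' (g t (hist r u t)) (g t 0)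
    linarith [h.g_zero t ht]
  · exact h.norm_convolution_le ((norm_nonneg _).trans (h.norm_forcing_le u le_rfl))
      (fun s hs => h.norm_forcing_le u hs) ht

theorem norm_mildRhs_sub_le (h : MildData r ω S g f k K J bg bf lg lf) (u v : ℝ →ᵇ X) (x : X)
    {t : ℝ} (ht : 0 ≤ t) :
    ‖mildRhs r S g f x u t - mildRhs r S g f x v t‖ ≤ (lg + lf * J) * ‖u - v‖ := by
  have hh : ∀ s, ‖hist r u s - hist r v s‖ ≤ ‖u - v‖ := fun s =>
    norm_hist_sub_le u.continuous v.continuous (norm_nonneg _) fun θ _ =>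
      (u - v).norm_coe_le_norm (s + θ)
  have hint : ∀ w : ℝ →ᵇ X, IntervalIntegrable (fun s => S (t - s) (f s (hist r w s)))
      volume 0 t := fun w =>
    (h.continuous_integrand (h.continuous_forcing w.continuous) t).intervalIntegrable _ _
  have heq : mildRhs r S g f x u t - mildRhs r S g f x v t =
      (g t (hist r u t) - g t (hist r v t)) +
        ∫ s in (0 : ℝ)..t, S (t - s) (f s (hist r u s) - f s (hist r v s)) := by
    simp only [map_sub]
    rw [intervalIntegral.integral_sub (hint u) (hint v)]
    simp only [mildRhs]
    abel
  rw [heq]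
  have h1 : ‖g t (hist r u t) - g t (hist r v t)‖ ≤ lg * ‖u - v‖ :=
    (h.g_lip t ht _ _).trans (mul_le_mul_of_nonneg_left (hh t) h.lg_nonneg)
  have h2 := h.norm_convolution_le (G := fun s => f s (hist r u s) - f s (hist r v s))
    (mul_nonneg h.lf_nonneg (norm_nonneg (u - v)))
    (fun s hs => (h.f_lip s hs _ _).trans (mul_le_mul_of_nonneg_left (hh s) h.lf_nonneg)) ht
  calc _ ≤ _ := norm_add_le _ _
    _ ≤ lg * ‖u - v‖ + lf * ‖u - v‖ * J := add_le_add h1 h2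
    _ = _ := by ring

theorem cesaroNull_k (h : MildData r ω S g f k K J bg bf lg lf) : CesaroNull r k :=
  CesaroNull.of_antitoneOn h.r_pos (fun _ ht => h.k_nonneg ht) h.k_anti h.k_sum

/-- Increments along the history of a curve with null increments are null, for any nonlinearity
that is Lipschitz and has null increments along bounded curves. -/
theorem cesaroNull_comp_hist (h : MildData r ω S g f k K J bg bf lg lf)
    {F : ℝ → C(Icc (-r) (0 : ℝ), X) → X} {l : ℝ} (hl : 0 ≤ l)
    (hF : ∀ t ≥ 0, ∀ y z, ‖F t y - F t z‖ ≤ l * ‖y - z‖)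
    (hFn : ∀ L > 0, ∀ y : ℝ → C(Icc (-r) (0 : ℝ), X), (∀ t ≥ 0, ‖y t‖ ≤ L) →
      CesaroNull r fun t => ‖F (t + ω) (y t) - F t (y t)‖)
    {u : ℝ →ᵇ X} (hu : CesaroNull r fun t => ‖u (t + ω) - u t‖) :
    CesaroNull r fun t => ‖F (t + ω) (hist r u (t + ω)) - F t (hist r u t)‖ := by
  have hwin : CesaroNull r fun t => ‖hist r u (t + ω) - hist r u t‖ := by
    refine CesaroNull.window h.r_pos (B := 2 * ‖u‖) (fun t => ?_) hu fun t _ b hb hbt => ?_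
    · refine (norm_sub_le _ _).trans ?_
      linarith [u.norm_coe_le_norm (t + ω), u.norm_coe_le_norm t]
    · refine norm_hist_sub_le u.continuous u.continuous hb fun θ hθ => ?_
      have := hbt (t + θ) ⟨by linarith [hθ.1], by linarith [hθ.2]⟩
      rwa [add_right_comm] at this
  refine CesaroNull.mono h.r_pos ((hFn (‖u‖ + 1) (by positivity) (hist r u) fun t _ =>
    (norm_hist_le u.continuous (norm_nonneg _) u.norm_coe_le_norm t).trans (by linarith)).add
      (hwin.const_mul hl)) fun t ht => ?_
  have hω := h.ω_pos
  calc _ = ‖(F (t + ω) (hist r u t) - F t (hist r u t)) +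
        (F (t + ω) (hist r u (t + ω)) - F (t + ω) (hist r u t))‖ := by congr 1; abel
    _ ≤ _ := (norm_add_le _ _).trans (add_le_add le_rfl (hF (t + ω) (by linarith) _ _))

theorem cesaroNull_mildRhs (h : MildData r ω S g f k K J bg bf lg lf) {u : ℝ →ᵇ X} (x : X)
    (hu : CesaroNull r fun t => ‖u (t + ω) - u t‖) :
    CesaroNull r fun t => ‖mildRhs r S g f x u (t + ω) - mildRhs r S g f x u t‖ := by
  have hω := h.ω_pos
  set F : ℝ → X := fun s => f s (hist r u s) with hFdef
  have hFc : Continuous F := h.continuous_forcing u.continuous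
  have hFb : ∀ s ≥ 0, ‖F s‖ ≤ bf + lf * ‖u‖ := fun s hs => h.norm_forcing_le u hs
  have hc0 : 0 ≤ bf + lf * ‖u‖ := (norm_nonneg _).trans (hFb 0 le_rfl)
  have hGc : Continuous fun s => F (s + ω) - F s := by fun_prop
  have hg := h.cesaroNull_comp_hist h.lg_nonneg h.g_lip h.g_null hu
  have hf := CesaroNull.convolution h.r_pos h.S_cont h.S_le h.k_anti h.k_sum hGc
    (h.cesaroNull_comp_hist h.lf_nonneg h.f_lip h.f_null hu)
  have hk := h.cesaroNull_k.const_mul (c := 2 * ‖x‖ + (bf + lf * ‖u‖) * ω) (by positivity)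
  refine CesaroNull.mono h.r_pos ((hk.add hg).add hf) fun t ht => ?_
  have htω : 0 ≤ t + ω := by linarith
  have hint : ∀ τ a b, IntervalIntegrable (fun s => S (τ - s) (F s)) volume a b :=
    fun τ a b => (h.continuous_integrand hFc τ).intervalIntegrable a b
  have hconv : (∫ s in (0 : ℝ)..t + ω, S (t + ω - s) (F s)) - ∫ s in (0 : ℝ)..t, S (t - s) (F s) =
      (∫ s in (0 : ℝ)..ω, S (t + ω - s) (F s)) +
        ∫ s in (0 : ℝ)..t, S (t - s) (F (s + ω) - F s) := by
    have hshift := intervalIntegral.integral_comp_add_right (a := 0) (b := t)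
      (fun s => S (t + ω - s) (F s)) ω
    rw [zero_add] at hshift
    simp only [add_sub_add_right_eq_sub] at hshift
    have hint' : IntervalIntegrable (fun s => S (t - s) (F (s + ω))) volume 0 t :=
      (h.continuous_integrand (G := fun s => F (s + ω)) (by fun_prop) t).intervalIntegrable _ _
    simp only [map_sub]
    rw [intervalIntegral.integral_sub hint' (hint t _ _), hshift,
      ← intervalIntegral.integral_add_adjacent_intervals (hint (t + ω) 0 ω) (hint _ ω (t + ω))]
    abel
  have hhead : ‖∫ s in (0 : ℝ)..ω, S (t + ω - s) (F s)‖ ≤ (bf + lf * ‖u‖) * ω * k t := by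
    refine (intervalIntegral.norm_integral_le_of_norm_le_const
      (C := k t * (bf + lf * ‖u‖)) fun s hs => ?_).trans (le_of_eq ?_)
    · rw [uIoc_of_le hω.le] at hs
      have hts : t ≤ t + ω - s := by linarith [hs.2]
      exact ((S _).le_opNorm _).trans (mul_le_mul
        ((h.S_le _ (ht.le.trans hts)).trans (h.k_anti ht (ht.le.trans hts) hts))
        (hFb s hs.1.le) (norm_nonneg _) (h.k_nonneg ht))
    · rw [sub_zero, abs_of_pos hω]
      ring
  have hSx : ‖S (t + ω) x - S t x‖ ≤ 2 * ‖x‖ * k t := by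
    have h1 : ‖S (t + ω) x‖ ≤ k t * ‖x‖ := ((S _).le_opNorm _).trans (mul_le_mul_of_nonneg_right
      ((h.S_le _ htω).trans (h.k_anti ht htω (by linarith))) (norm_nonneg _))
    have h2 : ‖S t x‖ ≤ k t * ‖x‖ := ((S _).le_opNorm _).trans (mul_le_mul_of_nonneg_right
      (h.S_le _ ht) (norm_nonneg _))
    refine (norm_sub_le _ _).trans ?_
    linarith
  have heq : mildRhs r S g f x u (t + ω) - mildRhs r S g f x u t =
      (S (t + ω) x - S t x) + (g (t + ω) (hist r u (t + ω)) - g t (hist r u t)) +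
        ((∫ s in (0 : ℝ)..ω, S (t + ω - s) (F s)) +
          ∫ s in (0 : ℝ)..t, S (t - s) (F (s + ω) - F s)) := by
    rw [← hconv]
    simp only [mildRhs, hFdef]
    abel
  rw [heq]
  refine norm_add₃_le.trans ?_
  have := norm_add_le (∫ s in (0 : ℝ)..ω, S (t + ω - s) (F s))
    (∫ s in (0 : ℝ)..t, S (t - s) (F (s + ω) - F s))
  simp only [hFdef] at *
  linarith

/-- The solution operator on bounded continuous functions on the line: the initial history is
extended constantly to the left and glued to the right-hand side of the equation at `0`. -/
noncomputable def solutionMap (h : MildData r ω S g f k K J bg bf lg lf)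
    (φ : C(Icc (-r) (0 : ℝ), X)) (x : X) (u : ℝ →ᵇ X) : ℝ →ᵇ X :=
  BoundedContinuousFunction.ofNormedAddCommGroup
    (fun t => mildRhs r S g f x u (max t 0) +
      (IccExtend (neg_nonpos.mpr h.r_pos.le) φ (min t 0) -
        IccExtend (neg_nonpos.mpr h.r_pos.le) φ 0))
    (((h.continuous_mildRhs u.continuous x).comp (continuous_id.max continuous_const)).add
      ((φ.continuous.Icc_extend'.comp (continuous_id.min continuous_const)).sub continuous_const))
    (k 0 * ‖x‖ + (bg + lg * ‖u‖) + (bf + lf * ‖u‖) * J + (‖φ‖ + ‖φ‖))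
    fun t => (norm_add_le _ _).trans (add_le_add (h.norm_mildRhs_le u x (le_max_right t 0))
      ((norm_sub_le _ _).trans (add_le_add (φ.norm_coe_le_norm _) (φ.norm_coe_le_norm _))))

theorem solutionMap_of_nonneg (h : MildData r ω S g f k K J bg bf lg lf)
    (φ : C(Icc (-r) (0 : ℝ), X)) (x : X) (u : ℝ →ᵇ X) {t : ℝ} (ht : 0 ≤ t) :
    h.solutionMap φ x u t = mildRhs r S g f x u t := by
  simp [solutionMap, max_eq_left ht, min_eq_right ht]

theorem solutionMap_of_nonpos (h : MildData r ω S g f k K J bg bf lg lf)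
    (φ : C(Icc (-r) (0 : ℝ), X)) (x : X) (u : ℝ →ᵇ X) {t : ℝ} (ht : t ≤ 0) :
    h.solutionMap φ x u t = mildRhs r S g f x u 0 +
      (IccExtend (neg_nonpos.mpr h.r_pos.le) φ t -
        IccExtend (neg_nonpos.mpr h.r_pos.le) φ 0) := by
  simp [solutionMap, max_eq_right ht, min_eq_left ht]

theorem contractingWith_solutionMap (h : MildData r ω S g f k K J bg bf lg lf)
    (φ : C(Icc (-r) (0 : ℝ), X)) (x : X) :
    ContractingWith (Real.toNNReal (lg + lf * J)) (h.solutionMap φ x) := by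
  have hc0 : 0 ≤ lg + lf * J := add_nonneg h.lg_nonneg (mul_nonneg h.lf_nonneg h.J_nonneg)
  refine ⟨Real.toNNReal_lt_one.mpr h.small, LipschitzWith.of_dist_le_mul fun u v => ?_⟩
  rw [Real.coe_toNNReal _ hc0]
  refine (BoundedContinuousFunction.dist_le (mul_nonneg hc0 dist_nonneg)).mpr fun t => ?_
  rw [dist_eq_norm, dist_eq_norm]
  have : h.solutionMap φ x u t - h.solutionMap φ x v t =
      mildRhs r S g f x u (max t 0) - mildRhs r S g f x v (max t 0) := by
    simp [solutionMap]
  rw [this]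
  exact h.norm_mildRhs_sub_le u v x (le_max_right t 0)

variable [CompleteSpace X]

/-- Existence of a solution with null increments, and uniqueness among bounded continuous
functions on the line that are constant to the left of `-r`. -/
theorem exists_unique_solution (h : MildData r ω S g f k K J bg bf lg lf)
    (φ : C(Icc (-r) (0 : ℝ), X)) (x : X)
    (hx : x = IccExtend (neg_nonpos.mpr h.r_pos.le) φ 0 - g 0 φ) :
    ∃ u : ℝ →ᵇ X, (∀ θ : Icc (-r) (0 : ℝ), u θ = φ θ) ∧
      (∀ t ≥ 0, u t = mildRhs r S g f x u t) ∧
      (CesaroNull r fun t => ‖u (t + ω) - u t‖) ∧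
      ∀ v : ℝ →ᵇ X, (∀ t ≤ 0, v t = IccExtend (neg_nonpos.mpr h.r_pos.le) φ t) →
        (∀ t ≥ 0, v t = mildRhs r S g f x v t) → v = u := by
  have hT := h.contractingWith_solutionMap φ x
  set u := ContractingWith.fixedPoint (h.solutionMap φ x) hT with hu
  have hfix : h.solutionMap φ x u = u := hT.fixedPoint_isFixedPt
  set φe := IccExtend (neg_nonpos.mpr h.r_pos.le) φ with hφe
  have hrhs0 : ∀ v : ℝ → X, mildRhs r S g f x v 0 = φe 0 + (g 0 (hist r v 0) - g 0 φ) := by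
    intro v
    simp only [mildRhs, h.S_zero, hx, intervalIntegral.integral_same]
    simp only [one_apply_eq_self]
    abel
  set c : X := g 0 (hist r u 0) - g 0 φ with hc
  have hneg : ∀ t ≤ 0, u t = φe t + c := fun t ht => by
    rw [← hfix, h.solutionMap_of_nonpos φ x u ht, hrhs0, ← hc, ← hφe]
    abel
  have hc0 : c = 0 := by
    have h1 : ‖hist r u 0 - φ‖ ≤ ‖c‖ := by
      refine (ContinuousMap.norm_le _ (norm_nonneg _)).mpr fun θ => ?_
      rw [ContinuousMap.sub_apply, hist_apply u.continuous, zero_add, hneg θ θ.2.2, hφe,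
        IccExtend_val, add_sub_cancel_left]
    have h2 : ‖c‖ ≤ lg * ‖c‖ := (h.g_lip 0 le_rfl _ _).trans
      (mul_le_mul_of_nonneg_left h1 h.lg_nonneg)
    have h3 : lg < 1 := lt_of_le_of_lt
      (le_add_of_nonneg_right (mul_nonneg h.lf_nonneg h.J_nonneg)) h.small
    by_contra hne
    have : 0 < ‖c‖ := norm_pos_iff.mpr hne
    nlinarith
  refine ⟨u, fun θ => ?_, fun t ht => ?_, ?_, fun v hv0 hv => ?_⟩
  · rw [hneg θ θ.2.2, hc0, add_zero, hφe, IccExtend_val]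
  · conv_lhs => rw [← hfix]
    exact h.solutionMap_of_nonneg φ x u ht
  · have hinv : ∀ v : ℝ →ᵇ X, (CesaroNull r fun t => ‖v (t + ω) - v t‖) →
        CesaroNull r fun t => ‖h.solutionMap φ x v (t + ω) - h.solutionMap φ x v t‖ := by
      intro v hv
      refine (h.cesaroNull_mildRhs x hv).mono h.r_pos fun t ht => ?_
      have hω := h.ω_pos
      rw [h.solutionMap_of_nonneg φ x v ht, h.solutionMap_of_nonneg φ x v (by linarith)]
    have hiter : ∀ n, CesaroNull r fun t => ‖((h.solutionMap φ x)^[n] 0) (t + ω) -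
        ((h.solutionMap φ x)^[n] 0) t‖ := by
      intro n
      induction n with
      | zero => simpa using CesaroNull.zero
      | succ n ih =>
        simp only [Function.iterate_succ_apply']
        exact hinv _ ih
    exact (isClosed_cesaroNull (ω := ω) h.r_pos).mem_of_tendsto
      (hT.tendsto_iterate_fixedPoint 0) (Eventually.of_forall hiter)
  · refine hT.fixedPoint_unique ?_
    ext t
    rcases le_total 0 t with ht | ht
    · rw [h.solutionMap_of_nonneg φ x v ht, hv t ht]
    · rw [h.solutionMap_of_nonpos φ x v ht, ← hv 0 le_rfl, hv0 0 le_rfl, hv0 t ht]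
      abel

end MildData

end Mild

theorem sum_range_antitoneOn_le {r J : ℝ} (hr : 0 < r) {k : ℝ → ℝ} (hkc : Continuous k)
    (hk : AntitoneOn k (Ici 0)) (hJ : ∀ t ≥ 0, ∫ s in (0 : ℝ)..t, k s ≤ J)
    (hk0 : ∀ t ≥ 0, 0 ≤ k t) (N : ℕ) :
    ∑ n ∈ Finset.range N, k (n * r) ≤ k 0 + J / r := by
  cases N with
  | zero =>
    have hJ0 : 0 ≤ J := by simpa using hJ 0 le_rfl
    have := hk0 0 le_rfl
    simp only [Finset.range_zero, Finset.sum_empty]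
    positivity
  | succ M =>
    rw [Finset.sum_range_succ', add_comm]
    refine add_le_add (by simp) ?_
    rw [le_div_iff₀ hr, Finset.sum_mul]
    refine le_trans ?_ (hJ (M * r) (by positivity))
    have := intervalIntegral.sum_integral_adjacent_intervals (f := k) (μ := volume)
      (a := fun n : ℕ => (n : ℝ) * r) (n := M) fun n _ => hkc.intervalIntegrable _ _
    simp only [Nat.cast_zero, zero_mul] at this
    rw [← this]
    refine Finset.sum_le_sum fun n _ => ?_
    have hn : (n : ℝ) * r ≤ ((n + 1 : ℕ) : ℝ) * r := by gcongr; omega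
    have hn0 : (0 : ℝ) ≤ n * r := by positivity
    calc k (((n + 1 : ℕ) : ℝ) * r) * r
        = ∫ _ in (n * r : ℝ)..((n + 1 : ℕ) : ℝ) * r, k (((n + 1 : ℕ) : ℝ) * r) := by
          rw [intervalIntegral.integral_const, smul_eq_mul]
          push_cast
          ring
      _ ≤ ∫ s in (n * r : ℝ)..((n + 1 : ℕ) : ℝ) * r, k s :=
          intervalIntegral.integral_mono_on hn intervalIntegrable_const
            (hkc.intervalIntegrable _ _) fun s hs =>
              hk (hn0.trans hs.1) (hn0.trans hn) hs.2

/-- A strongly continuous family on `[0, ∞)` with uniformly bounded norms is jointly continuous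
once extended constantly to the left. -/
theorem continuous_strongly_continuous_family {X : Type*} [NormedAddCommGroup X] [NormedSpace ℝ X]
    {S : ℝ → X →L[ℝ] X} (hS : ∀ x : X, ContinuousOn (fun t => S t x) (Ici 0)) {A : ℝ}
    (hA : ∀ t ≥ 0, ‖S t‖ ≤ A) : Continuous fun p : ℝ × X => S (max p.1 0) p.2 := by
  refine continuous_iff_continuousAt.mpr fun ⟨t₀, x₀⟩ => ?_
  have hcont : Continuous fun t : ℝ => S (max t 0) x₀ :=
    (hS x₀).comp_continuous (continuous_id.max continuous_const) fun t => le_max_right t 0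
  refine tendsto_iff_norm_sub_tendsto_zero.mpr ?_
  have hlim : Tendsto (fun p : ℝ × X => A * ‖p.2 - x₀‖ + ‖S (max p.1 0) x₀ - S (max t₀ 0) x₀‖)
      (nhds (t₀, x₀)) (nhds 0) := by
    have hc : Continuous fun p : ℝ × X =>
        A * ‖p.2 - x₀‖ + ‖S (max p.1 0) x₀ - S (max t₀ 0) x₀‖ :=
      (continuous_const.mul (continuous_snd.sub continuous_const).norm).add
        ((hcont.comp continuous_fst).sub continuous_const).norm
    simpa using hc.tendsto (t₀, x₀)
  refine squeeze_zero (fun _ => norm_nonneg _) (fun p => ?_) hlim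
  calc ‖S (max p.1 0) p.2 - S (max t₀ 0) x₀‖
      = ‖S (max p.1 0) (p.2 - x₀) + (S (max p.1 0) x₀ - S (max t₀ 0) x₀)‖ := by
        rw [map_sub]; congr 1; abel
    _ ≤ _ := (norm_add_le _ _).trans (add_le_add (((S _).le_opNorm _).trans
        (mul_le_mul_of_nonneg_right (hA _ (le_max_right _ _)) (norm_nonneg _))) le_rfl)

theorem mildRhs_max {X : Type*} [NormedAddCommGroup X] [NormedSpace ℝ X] {r : ℝ}
    (S : ℝ → X →L[ℝ] X) (g f : ℝ → C(Icc (-r) (0 : ℝ), X) → X) (x : X) (u : ℝ → X) {t : ℝ}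
    (ht : 0 ≤ t) :
    mildRhs r (fun t => S (max t 0)) (fun t => g (max t 0)) (fun t => f (max t 0)) x u t =
      mildRhs r S g f x u t := by
  simp only [mildRhs, max_eq_left ht]
  congr 1
  refine intervalIntegral.integral_congr fun s hs => ?_
  rw [uIcc_of_le ht] at hs
  simp only [max_eq_left hs.1, max_eq_left (sub_nonneg.mpr hs.2)]

theorem le_biSup_Ici {L : ℝ → ℝ} (hpos : ∀ t ≥ (0 : ℝ), 0 ≤ L t)
    (hbdd : ∃ B, ∀ t ≥ (0 : ℝ), L t ≤ B) {t : ℝ} (ht : 0 ≤ t) : L t ≤ ⨆ t ∈ Ici (0 : ℝ), L t := by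
  obtain ⟨B, hB⟩ := hbdd
  have hB0 : 0 ≤ B := (hpos 0 le_rfl).trans (hB 0 le_rfl)
  refine le_ciSup_of_le ⟨B, ?_⟩ t ?_
  · rintro _ ⟨s, rfl⟩
    exact Real.iSup_le (fun hs => hB s hs) hB0
  · rw [ciSup_pos (show t ∈ Ici (0 : ℝ) from ht)]

/-- The increment hypothesis of `MildData` for a Lipschitz nonlinearity that is uniformly pseudo
S-asymptotically periodic. -/
theorem PSAPunif.cesaroNull_max {E Y : Type*} [NormedAddCommGroup E] [NormedAddCommGroup Y]
    {ω r B l : ℝ} (hr : 0 < r) (hω : 0 < ω) {F : ℝ → E → Y} (hF : PSAPunif ω r F)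
    (hc : ContinuousOn (fun p : ℝ × E => F p.1 p.2) (Ici 0 ×ˢ univ)) (hl : 0 ≤ l)
    (hB : ∀ t ≥ 0, ‖F t 0‖ ≤ B) (hlip : ∀ t ≥ 0, ∀ x z, ‖F t x - F t z‖ ≤ l * ‖x - z‖)
    (L : ℝ) (hL : 0 < L) (y : ℝ → E) (hy : ∀ t ≥ 0, ‖y t‖ ≤ L) :
    CesaroNull r fun t => ‖F (max (t + ω) 0) (y t) - F (max t 0) (y t)‖ := by
  refine (hF.cesaroNull hr hω hc hL (B := B + l * L) (fun t ht x hx => ?_) hy).mono hr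
    fun t ht => ?_
  · have h1 := hlip t ht x 0
    rw [sub_zero] at h1
    have h2 := norm_le_insert' (F t x) (F t 0)
    have h3 : l * ‖x‖ ≤ l * L := mul_le_mul_of_nonneg_left hx hl
    linarith [hB t ht]
  · rw [max_eq_left ht, max_eq_left (add_nonneg ht hω.le)]

/-- Theorem 3.1: under hypotheses (H₁), (H₃) and the smallness
condition `‖L_g‖_∞ + ‖L_f‖_∞ CM|μ|^{−1/α}π/(α sin(π/α)) < 1`, system (1.2) has a unique
mild solution `u` with `u|_{[0,∞)} ∈ PSAP_{ω,r}(X)`. -/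
theorem existence_uniqueness_thm31 {X : Type*} [NormedAddCommGroup X] [NormedSpace ℝ X]
    [CompleteSpace X]
    (α μ C M r ω : ℝ) (hα1 : 1 < α) (hα2 : α < 2) (hμ : μ < 0) (hC : 0 < C) (hM : 0 < M)
    (hr : 0 < r) (hω : 0 < ω)
    (S : ℝ → X →L[ℝ] X)
    (hScont : ∀ x : X, ContinuousOn (fun t => S t x) (Set.Ici 0))
    (hS0 : S 0 = 1)
    (hSb : ∀ t ≥ (0:ℝ), ‖S t‖ ≤ C * M / (1 + |μ| * t ^ α))
    (φ : C(Set.Icc (-r) (0:ℝ), X))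
    (g f : ℝ → C(Set.Icc (-r) (0:ℝ), X) → X)
    (hgcont : ContinuousOn (fun p : ℝ × C(Set.Icc (-r) (0:ℝ), X) => g p.1 p.2)
      (Set.Ici 0 ×ˢ Set.univ))
    (hfcont : ContinuousOn (fun p : ℝ × C(Set.Icc (-r) (0:ℝ), X) => f p.1 p.2)
      (Set.Ici 0 ×ˢ Set.univ))
    (hgP : PSAPunif ω r g) (hfP : PSAPunif ω r f)
    (hg0 : ∃ B, ∀ t ≥ (0:ℝ), ‖g t 0‖ ≤ B) (hf0 : ∃ B, ∀ t ≥ (0:ℝ), ‖f t 0‖ ≤ B)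
    (Lg Lf : ℝ → ℝ)
    (hLgcont : ContinuousOn Lg (Set.Ici 0)) (hLfcont : ContinuousOn Lf (Set.Ici 0))
    (hLgpos : ∀ t ≥ (0:ℝ), 0 ≤ Lg t) (hLfpos : ∀ t ≥ (0:ℝ), 0 ≤ Lf t)
    (hLgbdd : ∃ B, ∀ t ≥ (0:ℝ), Lg t ≤ B) (hLfbdd : ∃ B, ∀ t ≥ (0:ℝ), Lf t ≤ B)
    (hgLip : ∀ t ≥ (0:ℝ), ∀ ψ₁ ψ₂ : C(Set.Icc (-r) (0:ℝ), X),
      ‖g t ψ₁ - g t ψ₂‖ ≤ Lg t * ‖ψ₁ - ψ₂‖)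
    (hfLip : ∀ t ≥ (0:ℝ), ∀ ψ₁ ψ₂ : C(Set.Icc (-r) (0:ℝ), X),
      ‖f t ψ₁ - f t ψ₂‖ ≤ Lf t * ‖ψ₁ - ψ₂‖)
    (hsmall : (⨆ t ∈ Set.Ici (0:ℝ), Lg t) +
      (⨆ t ∈ Set.Ici (0:ℝ), Lf t) *
        (C * M * |μ| ^ (-(1 / α)) * Real.pi / (α * Real.sin (Real.pi / α))) < 1) :
    ∃ u : ℝ → X,
      (IsMildSolution r (Set.right_mem_Icc.mpr (by linarith)) S φ g f u ∧ PSAPclass ω r u) ∧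
      ∀ v : ℝ → X,
        IsMildSolution r (Set.right_mem_Icc.mpr (by linarith)) S φ g f v ∧ PSAPclass ω r v →
        ∀ t ≥ -r, v t = u t := by
  set k : ℝ → ℝ := fun t => C * M / (1 + |μ| * |t| ^ α) with hk
  set J : ℝ := C * M * |μ| ^ (-(1 / α)) * Real.pi / (α * Real.sin (Real.pi / α)) with hJ
  set lg : ℝ := ⨆ t ∈ Set.Ici (0:ℝ), Lg t with hlg
  set lf : ℝ := ⨆ t ∈ Set.Ici (0:ℝ), Lf t with hlf
  obtain ⟨bg, hbg⟩ := hg0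
  obtain ⟨bf, hbf⟩ := hf0
  have hCM : 0 ≤ C * M := by positivity
  have hμ' : 0 < |μ| := abs_pos.mpr hμ.ne
  have hα0 : 0 < α := by linarith
  have hden : ∀ t : ℝ, 0 < 1 + |μ| * |t| ^ α := fun t => by positivity
  have hkc : Continuous k := continuous_const.div
    (continuous_const.add (continuous_const.mul
      (continuous_abs.rpow_const fun _ => Or.inr hα0.le))) fun t => (hden t).ne'
  have hk0 : ∀ t ≥ 0, 0 ≤ k t := fun t _ => div_nonneg hCM (hden t).le
  have hkanti : AntitoneOn k (Ici 0) := fun s hs t ht hst => by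
    have hs' : 0 ≤ s := hs
    have ht' : 0 ≤ t := ht
    simp only [hk, abs_of_nonneg hs', abs_of_nonneg ht']
    gcongr
  have hkint : ∀ t ≥ 0, ∫ s in (0 : ℝ)..t, k s ≤ J := fun t ht =>
    integral_div_one_add_mul_rpow_le hα1 hμ' hCM ht
  have hSk : ∀ t ≥ 0, ‖S t‖ ≤ k t := fun t ht => by
    simpa only [hk, abs_of_nonneg (show 0 ≤ t from ht)] using hSb t ht
  have hSA : ∀ t ≥ 0, ‖S t‖ ≤ k 0 := fun t ht =>
    (hSk t ht).trans (hkanti (mem_Ici.mpr le_rfl) ht ht)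
  have hgl : ∀ t ≥ (0 : ℝ), ∀ y z, ‖g t y - g t z‖ ≤ lg * ‖y - z‖ := fun t ht y z =>
    (hgLip t ht y z).trans (mul_le_mul_of_nonneg_right (le_biSup_Ici hLgpos hLgbdd ht)
      (norm_nonneg _))
  have hfl : ∀ t ≥ (0 : ℝ), ∀ y z, ‖f t y - f t z‖ ≤ lf * ‖y - z‖ := fun t ht y z =>
    (hfLip t ht y z).trans (mul_le_mul_of_nonneg_right (le_biSup_Ici hLfpos hLfbdd ht)
      (norm_nonneg _))
  have hlg0 : 0 ≤ lg := (hLgpos 0 le_rfl).trans (le_biSup_Ici hLgpos hLgbdd le_rfl)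
  have hlf0 : 0 ≤ lf := (hLfpos 0 le_rfl).trans (le_biSup_Ici hLfpos hLfbdd le_rfl)
  have hmax : Continuous fun p : ℝ × C(Icc (-r) (0 : ℝ), X) => (max p.1 0, p.2) :=
    (continuous_fst.max continuous_const).prodMk continuous_snd
  have hdata : MildData r ω (fun t => S (max t 0)) (fun t => g (max t 0))
      (fun t => f (max t 0)) k (k 0 + J / r) J bg bf lg lf :=
    { r_pos := hr
      ω_pos := hω
      S_cont := continuous_strongly_continuous_family hScont hSA
      S_zero := by simpa using hS0
      S_le := fun t ht => by simpa only [max_eq_left (show 0 ≤ t from ht)] using hSk t ht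
      k_cont := hkc
      k_anti := hkanti
      k_sum := sum_range_antitoneOn_le hr hkc hkanti hkint hk0
      k_int := hkint
      g_cont := hgcont.comp_continuous hmax fun p => ⟨mem_Ici.mpr (le_max_right p.1 0), mem_univ _⟩
      f_cont := hfcont.comp_continuous hmax fun p => ⟨mem_Ici.mpr (le_max_right p.1 0), mem_univ _⟩
      g_zero := fun t _ => hbg _ (le_max_right _ _)
      f_zero := fun t _ => hbf _ (le_max_right _ _)
      lg_nonneg := hlg0
      lf_nonneg := hlf0
      g_lip := fun t _ => hgl _ (le_max_right _ _)
      f_lip := fun t _ => hfl _ (le_max_right _ _)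
      g_null := hgP.cesaroNull_max hr hω hgcont hlg0 hbg hgl
      f_null := hfP.cesaroNull_max hr hω hfcont hlf0 hbf hfl
      small := hsmall }
  have hr0 : -r ≤ (0 : ℝ) := by linarith
  have h0 : (0 : ℝ) ∈ Icc (-r) (0 : ℝ) := Set.right_mem_Icc.mpr hr0
  obtain ⟨u, huφ, hueq, hunull, huniq⟩ := hdata.exists_unique_solution φ (φ ⟨0, h0⟩ - g 0 φ)
    (by rw [IccExtend_of_mem _ _ h0, max_self])
  refine ⟨u, ⟨⟨u.continuous.continuousOn, ⟨‖u‖, fun t _ => u.norm_coe_le_norm t⟩, huφ,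
    fun t ht => ?_⟩, hunull.psapClass hr⟩, fun v hv t ht => ?_⟩
  · rw [hueq t ht, mildRhs_max S g f _ _ ht]
    rfl
  · obtain ⟨⟨hvc, ⟨B, hB⟩, hvφ, hveq⟩, -⟩ := hv
    set w : BoundedContinuousFunction ℝ X := BoundedContinuousFunction.ofNormedAddCommGroup
      (fun t => v (max t (-r)))
      (hvc.comp_continuous (continuous_id.max continuous_const) fun t => le_max_right t (-r)) B
      (fun t => hB _ (le_max_right t (-r))) with hw
    have hwv : ∀ t ≥ -r, w t = v t := fun t ht => congrArg v (max_eq_left ht)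
    have hhist : ∀ t ≥ 0, hist r w t = hist r v t := fun t ht =>
      hist_congr fun θ => hwv _ (by linarith [θ.2.1])
    have hwu : w = u := by
      refine huniq w (fun t ht => ?_) fun t ht => ?_
      · have hm : max t (-r) ∈ Icc (-r) (0 : ℝ) := ⟨le_max_right _ _, max_le ht hr0⟩
        calc w t = φ ⟨max t (-r), hm⟩ := hvφ ⟨max t (-r), hm⟩
          _ = _ := by
            rw [IccExtend_apply]
            congr 1
            ext
            simp only [min_eq_right ht, max_comm]
      · rw [hwv t (by linarith), hveq t ht, mildRhs_max S g f _ _ ht, mildRhs, hhist t ht]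
        congr 1
        refine intervalIntegral.integral_congr fun s hs => ?_
        rw [uIcc_of_le ht] at hs
        simp only [hhist s hs.1]
    rw [← hwu, hwv t ht]
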